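/- Let K ⊆ ℝⁿ be a proper cone and let A ∈ ℝ^{n×n} be cross-positive over K, K-irreducible, and marginally stable in the sense that every eigenvalue of A over ℂ has nonpositive real part. Then: (i) for every s₀ > 0 the matrix s₀I − A is invertible and ⟨c, (s₀I − A)^{-1}b⟩ > 0 for every nonzero b ∈ K and every nonzero c ∈ K*; (ii) if 0 is an eigenvalue of A, then no nonzero b ∈ K lies in the column space Im(A) of A. Consequently, for such a marginally stable cone-invariant system, placing one sensor at any coordinate e_j ∈ K* successfully defends against every zero-dynamics attack d(t) = −e^{s₀t}d₀, s₀ ≥ 0, entering through any coordinate e_i ∈ K. -/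

import Mathlib

open Matrix

/-- A proper cone in `ℝⁿ`: a closed convex cone that is pointed and solid. -/
def IsProperCone {n : ℕ} (K : Set (Fin n → ℝ)) : Prop :=
  IsClosed K ∧
  (∀ x ∈ K, ∀ y ∈ K, x + y ∈ K) ∧
  (∀ a : ℝ, 0 ≤ a → ∀ x ∈ K, a • x ∈ K) ∧
  (∀ x, x ∈ K → -x ∈ K → x = 0) ∧
  (interior K).Nonempty

/-- The dual cone with respect to the standard inner product on `ℝⁿ`. -/
def dualCone {n : ℕ} (K : Set (Fin n → ℝ)) : Set (Fin n → ℝ) :=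
  {y | ∀ x ∈ K, 0 ≤ y ⬝ᵥ x}

/-- `A` is cross-positive over `K`. -/
def CrossPositive {n : ℕ} (K : Set (Fin n → ℝ)) (A : Matrix (Fin n) (Fin n) ℝ) : Prop :=
  ∀ x ∈ K, ∀ y ∈ dualCone K, y ⬝ᵥ x = 0 → 0 ≤ y ⬝ᵥ A.mulVec x

/-- `μ` is an eigenvalue of the complex matrix `M`. -/
def HasEigen {n : ℕ} (M : Matrix (Fin n) (Fin n) ℂ) (μ : ℂ) : Prop :=
  ∃ v : Fin n → ℂ, v ≠ 0 ∧ M.mulVec v = μ • v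

lemma cone_sum {n : ℕ} (F : Set (Fin n → ℝ)) (h0 : (0 : Fin n → ℝ) ∈ F)
    (hadd : ∀ x ∈ F, ∀ y ∈ F, x + y ∈ F) (s : Finset (Fin n → ℝ))
    (g : (Fin n → ℝ) → (Fin n → ℝ)) (hg : ∀ a ∈ s, g a ∈ F) : ∑ a ∈ s, g a ∈ F := by
  classical
  induction s using Finset.induction_on with
  | empty => simpa using h0
  | insert a s ha ih =>
    rw [Finset.sum_insert ha]
    exact hadd _ (hg a (by simp)) _ (ih fun b hb => hg b (by simp [hb]))

/-- A convex cone in finite dimension has an order unit. -/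
lemma order_unit {n : ℕ} (F : Set (Fin n → ℝ)) (h0 : (0 : Fin n → ℝ) ∈ F)
    (hadd : ∀ x ∈ F, ∀ y ∈ F, x + y ∈ F)
    (hsmul : ∀ a : ℝ, 0 ≤ a → ∀ x ∈ F, a • x ∈ F) :
    ∃ u ∈ F, ∀ v ∈ F, ∃ δ : ℝ, 0 < δ ∧ u - δ • v ∈ F := by
  classical
  obtain ⟨b, hbF, hspan, hli⟩ := exists_linearIndependent ℝ F
  have hfin : b.Finite := hli.setFinite
  lift b to Finset (Fin n → ℝ) using hfin
  refine ⟨∑ a ∈ b, a, cone_sum F h0 hadd b (fun a => a) (fun a ha => hbF ha), ?_⟩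
  intro v hv
  have hv' : v ∈ Submodule.span ℝ (b : Set (Fin n → ℝ)) := by
    rw [hspan]; exact Submodule.subset_span hv
  obtain ⟨f, -, hf⟩ := Submodule.mem_span_finset.1 hv'
  have hS : 0 ≤ ∑ a ∈ b, |f a| := Finset.sum_nonneg fun _ _ => abs_nonneg _
  refine ⟨1 / (1 + ∑ a ∈ b, |f a|), by positivity, ?_⟩
  have : ∑ a ∈ b, a - (1 / (1 + ∑ a ∈ b, |f a|)) • v
      = ∑ a ∈ b, (1 - (1 / (1 + ∑ a ∈ b, |f a|)) * f a) • a := by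
    rw [← hf, Finset.smul_sum, ← Finset.sum_sub_distrib]
    refine Finset.sum_congr rfl fun a _ => ?_
    rw [sub_smul, one_smul, mul_smul]
  rw [this]
  refine cone_sum F h0 hadd b _ fun a ha => hsmul _ ?_ _ (hbF ha)
  have h1 : |f a| ≤ ∑ a ∈ b, |f a| :=
    Finset.single_le_sum (f := fun a => |f a|) (fun _ _ => abs_nonneg _) ha
  have h2 := le_abs_self (f a)
  rw [sub_nonneg, one_div, inv_mul_le_iff₀ (by positivity)]
  linarith

lemma clm_dot {n : ℕ} (f : (Fin n → ℝ) →L[ℝ] ℝ) : ∃ y : Fin n → ℝ, ∀ x, f x = y ⬝ᵥ x := by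
  refine ⟨fun i => f (Pi.single i 1), fun x => ?_⟩
  have := LinearMap.pi_apply_eq_sum_univ (f : (Fin n → ℝ) →ₗ[ℝ] ℝ) x
  simp only [ContinuousLinearMap.coe_coe] at this
  rw [this, dotProduct]
  refine Finset.sum_congr rfl fun i _ => ?_
  rw [smul_eq_mul, mul_comm]
  congr 2
  ext j
  simp [Pi.single_apply, eq_comm]

lemma cone_zero {n : ℕ} {K : Set (Fin n → ℝ)} (hK : IsProperCone K) : (0 : Fin n → ℝ) ∈ K := by
  obtain ⟨_, _, hs, _, ⟨u, hu⟩⟩ := hK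
  simpa using hs 0 le_rfl u (interior_subset hu)

lemma cone_convex {n : ℕ} {K : Set (Fin n → ℝ)} (hK : IsProperCone K) : Convex ℝ K := by
  intro x hx y hy a b ha hb _
  exact hK.2.1 _ (hK.2.2.1 a ha x hx) _ (hK.2.2.1 b hb y hy)

/-- separation of a point from the cone -/
lemma cone_sep {n : ℕ} {K : Set (Fin n → ℝ)} (hK : IsProperCone K) (x : Fin n → ℝ)
    (hx : x ∉ K) : ∃ y ∈ dualCone K, y ⬝ᵥ x < 0 := by
  obtain ⟨f, u, hfx, hfK⟩ := geometric_hahn_banach_point_closed (cone_convex hK) hK.1 hx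
  obtain ⟨y, hy⟩ := clm_dot f
  have hu : u < 0 := by simpa using hfK 0 (cone_zero hK)
  refine ⟨y, fun z hz => ?_, by rw [← hy]; linarith⟩
  rw [← hy]
  by_contra! h
  have := hfK _ (hK.2.2.1 (u / f z) (div_nonneg_of_nonpos hu.le h.le) z hz)
  rw [map_smul, smul_eq_mul, div_mul_cancel₀ _ h.ne] at this
  exact lt_irrefl _ this

lemma dual_pos {n : ℕ} {K : Set (Fin n → ℝ)} {y u : Fin n → ℝ} (hy : y ∈ dualCone K)
    (hy0 : y ≠ 0) (hu : u ∈ interior K) : 0 < y ⬝ᵥ u := by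
  have hc : Continuous fun ε : ℝ => u - ε • y := by fun_prop
  have : ∀ᶠ ε in nhds (0 : ℝ), u - ε • y ∈ interior K :=
    hc.continuousAt.eventually_mem (by simpa using isOpen_interior.mem_nhds hu)
  obtain ⟨r, hr, hb⟩ := Metric.eventually_nhds_iff.1 this
  have h1 := hy _ (interior_subset (hb (y := r / 2) (by simp [abs_of_pos hr]; linarith)))
  rw [dotProduct_sub, dotProduct_smul, smul_eq_mul] at h1
  have h2 : 0 < y ⬝ᵥ y := by
    have : 0 ≤ y ⬝ᵥ y := Finset.sum_nonneg fun i _ => mul_self_nonneg _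
    refine lt_of_le_of_ne this fun h => hy0 (dotProduct_self_eq_zero.1 h.symm)
  nlinarith

/-- supporting functional at a boundary point -/
lemma cone_support {n : ℕ} {K : Set (Fin n → ℝ)} (hK : IsProperCone K) (x : Fin n → ℝ)
    (hx : x ∈ K) (hxi : x ∉ interior K) : ∃ y ∈ dualCone K, y ≠ 0 ∧ y ⬝ᵥ x = 0 := by
  obtain ⟨f, hf⟩ := geometric_hahn_banach_open_point (cone_convex hK).interior isOpen_interior hxi
  obtain ⟨u, hu⟩ := hK.2.2.2.2
  have hle : ∀ a ∈ K, f a ≤ f x := by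
    intro a ha
    have hcl : a ∈ closure (interior K) := by
      rw [(cone_convex hK).closure_interior_eq_closure_of_nonempty_interior ⟨u, hu⟩]
      exact subset_closure ha
    exact closure_minimal (fun z hz => (hf z hz).le) (isClosed_le f.continuous continuous_const) hcl
  have h0 : 0 ≤ f x := by simpa using hle 0 (cone_zero hK)
  have h2 : f x = 0 := by
    have := hle _ (hK.2.2.1 2 (by norm_num) x hx)
    rw [map_smul, smul_eq_mul] at this
    linarith
  obtain ⟨y, hy⟩ := clm_dot f
  refine ⟨-y, fun z hz => ?_, ?_, ?_⟩
  · have := hle z hz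
    rw [neg_dotProduct, ← hy]; linarith
  · intro h
    have h3 := hf u hu
    rw [neg_eq_zero] at h
    rw [hy, hy, h] at h3
    simp at h3
  · rw [neg_dotProduct, ← hy, h2, neg_zero]

/-- strictly positive functional -/
lemma cone_phi {n : ℕ} {K : Set (Fin n → ℝ)} (hK : IsProperCone K) :
    ∃ φ ∈ dualCone K, ∃ C : ℝ, 0 < C ∧ ∀ z ∈ K, ‖z‖ ≤ C * (φ ⬝ᵥ z) := by
  obtain ⟨φ, hφ, hu⟩ := order_unit (dualCone K) (fun x _ => by simp)
    (fun x hx y hy z hz => by rw [add_dotProduct]; exact add_nonneg (hx z hz) (hy z hz))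
    (fun a ha x hx z hz => by rw [smul_dotProduct]; exact mul_nonneg ha (hx z hz))
  have hpos : ∀ z ∈ K, z ≠ 0 → 0 < φ ⬝ᵥ z := by
    intro z hz hz0
    obtain ⟨y, hy, hyz⟩ := cone_sep hK (-z) (fun h => hz0 (hK.2.2.2.1 z hz h))
    obtain ⟨δ, hδ, h⟩ := hu y hy
    have := h z hz
    rw [sub_dotProduct, smul_dotProduct, smul_eq_mul] at this
    rw [dotProduct_neg] at hyz
    nlinarith
  have hcont : Continuous fun z : Fin n → ℝ => φ ⬝ᵥ z := by unfold dotProduct; fun_prop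
  have hcomp : IsCompact (K ∩ Metric.sphere 0 1) := (isCompact_sphere 0 1).inter_left hK.1
  refine ⟨φ, hφ, ?_⟩
  rcases (K ∩ Metric.sphere (0 : Fin n → ℝ) 1).eq_empty_or_nonempty with he | hne
  · refine ⟨1, one_pos, fun z hz => ?_⟩
    by_cases hz0 : z = 0
    · simp [hz0]
    · exfalso
      have : ‖z‖⁻¹ • z ∈ K ∩ Metric.sphere 0 1 :=
        ⟨hK.2.2.1 _ (by positivity) z hz, by
          simp [norm_smul, inv_mul_cancel₀ (norm_ne_zero_iff.2 hz0)]⟩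
      rw [he] at this; exact this
  · obtain ⟨w, hw, hmin⟩ := hcomp.exists_isMinOn hne hcont.continuousOn
    have hw0 : w ≠ 0 := by
      rintro rfl; simpa using hw.2
    have hp := hpos w hw.1 hw0
    refine ⟨(φ ⬝ᵥ w)⁻¹, by positivity, fun z hz => ?_⟩
    by_cases hz0 : z = 0
    · simp [hz0]
    · have hm : ‖z‖⁻¹ • z ∈ K ∩ Metric.sphere 0 1 :=
        ⟨hK.2.2.1 _ (by positivity) z hz, by
          simp [norm_smul, inv_mul_cancel₀ (norm_ne_zero_iff.2 hz0)]⟩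
      have h := hmin hm
      simp only [Set.mem_ofPred_eq, dotProduct_smul, smul_eq_mul] at h
      have hn : 0 < ‖z‖ := norm_pos_iff.2 hz0
      rw [le_inv_mul_iff₀ hn] at h
      rw [le_inv_mul_iff₀ hp]; linarith

set_option maxHeartbeats 1000000 in
/-- Finite dimensional Krein-Rutman: a linear map preserving a closed cone with compact base has
an eigenvector in the cone. -/
lemma krein_rutman {n : ℕ} (F : Set (Fin n → ℝ)) (hcl : IsClosed F)
    (hadd : ∀ x ∈ F, ∀ y ∈ F, x + y ∈ F)
    (hsmul : ∀ a : ℝ, 0 ≤ a → ∀ x ∈ F, a • x ∈ F)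
    (φ : Fin n → ℝ) (C : ℝ) (hφ : ∀ z ∈ F, ‖z‖ ≤ C * (φ ⬝ᵥ z)) (hC : 0 < C)
    (T : Matrix (Fin n) (Fin n) ℝ) (hT : ∀ z ∈ F, T *ᵥ z ∈ F)
    (x : Fin n → ℝ) (hx : x ∈ F) (hx0 : x ≠ 0) :
    ∃ v ∈ F, v ≠ 0 ∧ ∃ ρ : ℝ, T *ᵥ v = ρ • v := by
  have h0 : (0 : Fin n → ℝ) ∈ F := by simpa using hsmul 0 le_rfl x hx
  have hφc : Continuous fun z : Fin n → ℝ => φ ⬝ᵥ z := by unfold dotProduct; fun_prop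
  have hTc : Continuous fun z : Fin n → ℝ => T *ᵥ z := by fun_prop
  have hnn : ∀ z ∈ F, 0 ≤ φ ⬝ᵥ z := fun z hz => by
    have := (norm_nonneg z).trans (hφ z hz)
    exact nonneg_of_mul_nonneg_right this hC
  have hpos : ∀ z ∈ F, z ≠ 0 → 0 < φ ⬝ᵥ z := fun z hz hz0 => by
    have := (norm_pos_iff.2 hz0).trans_le (hφ z hz)
    exact pos_of_mul_pos_right this hC.le
  obtain ⟨u, huF, hu⟩ := order_unit F h0 hadd hsmul
  have hu0 : u ≠ 0 := by
    rintro rfl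
    obtain ⟨δ, hδ, h⟩ := hu x hx
    have h1 := hnn _ h
    have h2 := hpos x hx hx0
    simp only [zero_sub, dotProduct_neg, dotProduct_smul, smul_eq_mul] at h1
    nlinarith
  -- compact base
  let B : Set (Fin n → ℝ) := F ∩ {z | φ ⬝ᵥ z = 1}
  have hBcl : IsClosed B := hcl.inter (isClosed_eq hφc continuous_const)
  have hB : IsCompact B := by
    refine Metric.isCompact_of_isClosed_isBounded hBcl ?_
    refine (Metric.isBounded_closedBall (x := (0 : Fin n → ℝ)) (r := C)).subset ?_
    rintro z ⟨hz, hz1⟩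
    have := hφ z hz
    rw [Set.mem_ofPred_eq] at hz1
    rw [hz1] at this
    simpa using this
  have hnorm : ∀ z ∈ F, z ≠ 0 → (φ ⬝ᵥ z)⁻¹ • z ∈ B := fun z hz hz0 =>
    ⟨hsmul _ (inv_nonneg.2 (hnn z hz)) z hz, by
      simp [inv_mul_cancel₀ (hpos z hz hz0).ne']⟩
  have hBne : B.Nonempty := ⟨_, hnorm x hx hx0⟩
  obtain ⟨M, hM⟩ : ∃ M : ℝ, ∀ z ∈ B, φ ⬝ᵥ (T *ᵥ z) ≤ M := by
    obtain ⟨M, hM⟩ := (hB.image (hφc.comp hTc)).bddAbove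
    exact ⟨M, fun z hz => hM ⟨z, hz, rfl⟩⟩
  let M' := M + φ ⬝ᵥ u
  have hup := hpos u huF hu0
  -- perturbed eigenvectors
  have key : ∀ ε : ℝ, 0 < ε → ε ≤ 1 → ∃ z ∈ B, ∃ ρ ∈ Set.Icc 0 M',
      T *ᵥ z + ε • u = ρ • z := by
    intro ε hε hε1
    let S : (Fin n → ℝ) → (Fin n → ℝ) := fun z => T *ᵥ z + (ε * (φ ⬝ᵥ z)) • u
    have hSc : Continuous S := by fun_prop
    have hSF : ∀ z ∈ F, S z ∈ F := fun z hz =>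
      hadd _ (hT z hz) _ (hsmul _ (mul_nonneg hε.le (hnn z hz)) u huF)
    have hSsub : ∀ a b : Fin n → ℝ, ∀ r : ℝ, S (a - r • b) = S a - r • S b := by
      intro a b r
      simp only [S, mulVec_sub, mulVec_smul, dotProduct_sub, dotProduct_smul, smul_eq_mul]
      module
    let P : Set (ℝ × (Fin n → ℝ)) := (Set.Icc 0 M' ×ˢ B) ∩ {p | S p.2 - p.1 • p.2 ∈ F}
    have hPc : IsCompact P := by
      refine (isCompact_Icc.prod hB).inter_right ?_
      exact hcl.preimage (by fun_prop : Continuous fun p : ℝ × (Fin n → ℝ) => S p.2 - p.1 • p.2)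
    have hbd : ∀ z ∈ B, ∀ ρ : ℝ, S z - ρ • z ∈ F → ρ ≤ M' := by
      intro z hz ρ h
      have h1 := hnn _ h
      have h2 := hM z hz
      have h3 : φ ⬝ᵥ z = 1 := hz.2
      simp only [S, dotProduct_sub, dotProduct_add, dotProduct_smul, smul_eq_mul, h3] at h1
      simp only [M']
      nlinarith
    obtain ⟨z0, hz0⟩ := hBne
    have hP0 : S z0 - (0 : ℝ) • z0 ∈ F := by simpa using hSF z0 hz0.1
    have hPne : P.Nonempty := ⟨(0, z0), ⟨⟨le_rfl, hbd z0 hz0 0 hP0⟩, hz0⟩, hP0⟩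
    obtain ⟨⟨ρ, z⟩, ⟨⟨hρ, hz⟩, hw⟩, hmax⟩ := hPc.exists_isMaxOn hPne continuous_fst.continuousOn
    simp only at hρ hz
    simp only [Set.mem_ofPred_eq] at hw
    have hz1 : φ ⬝ᵥ z = 1 := hz.2
    refine ⟨z, hz, ρ, hρ, ?_⟩
    have hSz : S z = T *ᵥ z + ε • u := by simp only [S, hz1, mul_one]
    rw [← hSz]
    by_contra hne
    have hw0 : S z - ρ • z ≠ 0 := sub_ne_zero.2 hne
    set w := S z - ρ • z with hwdef
    obtain ⟨δ, hδ, hδu⟩ := hu (S z) (hSF z hz.1)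
    have hwp := hpos w hw hw0
    have hε' : 0 < ε * (φ ⬝ᵥ w) := mul_pos hε hwp
    have hSz0 : S z ≠ 0 := by
      intro h
      have h1 := hnn _ (hT z hz.1)
      have h2 : φ ⬝ᵥ S z = 0 := by rw [h]; simp
      rw [hSz, dotProduct_add, dotProduct_smul, smul_eq_mul] at h2
      nlinarith
    have hn := hnorm (S z) (hSF z hz.1) hSz0
    set q := (φ ⬝ᵥ S z)⁻¹ with hq
    have hqp : 0 < q := inv_pos.2 (hpos _ (hSF z hz.1) hSz0)
    set η := ε * (φ ⬝ᵥ w) * δ with hη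
    have hηp : 0 < η := mul_pos hε' hδ
    have hmem : S (q • S z) - (ρ + η) • (q • S z) ∈ F := by
      have e1 : S w = S (S z) - ρ • S z := by rw [hwdef, hSsub]
      have e2 : S w = T *ᵥ w + (ε * (φ ⬝ᵥ w)) • u := rfl
      have e3 : S (q • S z) = q • S (S z) := by
        simp only [S, mulVec_smul, mulVec_add, dotProduct_add, dotProduct_smul, smul_eq_mul]
        module
      have e4 : S (q • S z) - (ρ + η) • (q • S z)
          = q • (T *ᵥ w + (ε * (φ ⬝ᵥ w)) • (u - δ • S z)) := by
        have : S (S z) = T *ᵥ w + (ε * (φ ⬝ᵥ w)) • u + ρ • S z := by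
          rw [← e2, e1]; abel
        rw [e3, this, hη]
        module
      rw [e4]
      exact hsmul _ hqp.le _ (hadd _ (hT w hw) _ (hsmul _ hε'.le _ hδu))
    have hmm : (ρ + η, q • S z) ∈ P :=
      ⟨⟨⟨by linarith [hρ.1], hbd _ hn _ hmem⟩, hn⟩, hmem⟩
    have := hmax hmm
    simp only [Set.mem_ofPred_eq] at this
    linarith
  -- limit
  have hcc : IsCompact (Set.Icc 0 M' ×ˢ B) := isCompact_Icc.prod hB
  have hne : (Set.Icc 0 M' ×ˢ B).Nonempty := by
    obtain ⟨z, hz, ρ, hρ, -⟩ := key 1 one_pos le_rfl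
    exact ⟨(ρ, z), hρ, hz⟩
  obtain ⟨⟨ρ, z⟩, ⟨hρ, hz⟩, hmin⟩ := hcc.exists_isMinOn hne
    (f := fun p : ℝ × (Fin n → ℝ) => ‖T *ᵥ p.2 - p.1 • p.2‖)
    (by fun_prop : Continuous fun p : ℝ × (Fin n → ℝ) => ‖T *ᵥ p.2 - p.1 • p.2‖).continuousOn
  simp only at hρ hz
  refine ⟨z, hz.1, ?_, ρ, ?_⟩
  · rintro rfl
    have := hz.2
    simp at this
  · rw [← sub_eq_zero, ← norm_eq_zero]
    by_contra hpp
    have hp : 0 < ‖T *ᵥ z - ρ • z‖ := lt_of_le_of_ne (norm_nonneg _) (Ne.symm hpp)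
    have hun : 0 < ‖u‖ := norm_pos_iff.2 hu0
    set m := ‖T *ᵥ z - ρ • z‖
    obtain ⟨z', hz', ρ', hρ', he⟩ := key (min 1 (m / (2 * ‖u‖))) (by positivity) (min_le_left _ _)
    have h1 : m ≤ ‖T *ᵥ z' - ρ' • z'‖ :=
      isMinOn_iff.1 hmin (ρ', z') ⟨hρ', hz'⟩
    have h2 : T *ᵥ z' - ρ' • z' = -((min 1 (m / (2 * ‖u‖))) • u) := by rw [← he]; abel
    rw [h2, norm_neg, norm_smul, Real.norm_of_nonneg (by positivity)] at h1
    have h3 : min 1 (m / (2 * ‖u‖)) * ‖u‖ ≤ m / (2 * ‖u‖) * ‖u‖ :=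
      mul_le_mul_of_nonneg_right (min_le_right _ _) hun.le
    have h4 : m / (2 * ‖u‖) * ‖u‖ = m / 2 := by field_simp
    linarith

lemma inv_cont {n : ℕ} (M : ℝ → Matrix (Fin n) (Fin n) ℝ) (hM : Continuous M) (b : Fin n → ℝ)
    (x : ℝ) (hx : IsUnit (M x)) : ContinuousAt (fun t => (M t)⁻¹ *ᵥ b) x := by
  have hd : (M x).det ≠ 0 := ((Matrix.isUnit_iff_isUnit_det _).1 hx).ne_zero
  have h1 : ContinuousAt (fun t => (M t).det) x := hM.matrix_det.continuousAt
  have h2 : ContinuousAt (fun t => (M t).adjugate *ᵥ b) x :=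
    (hM.matrix_adjugate.matrix_mulVec continuous_const).continuousAt
  have : (fun t => (M t)⁻¹ *ᵥ b) = fun t => ((M t).det)⁻¹ • ((M t).adjugate *ᵥ b) := by
    ext1 t
    rw [Matrix.inv_def, Ring.inverse_eq_inv', smul_mulVec]
  rw [this]
  exact (h1.inv₀ hd).smul h2

lemma mul_inv_vec {n : ℕ} {M : Matrix (Fin n) (Fin n) ℝ} (h : IsUnit M) (b : Fin n → ℝ) :
    M *ᵥ (M⁻¹ *ᵥ b) = b := by
  rw [mulVec_mulVec, Matrix.mul_nonsing_inv _ ((Matrix.isUnit_iff_isUnit_det _).1 h), one_mulVec]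

lemma inv_mul_vec {n : ℕ} {M : Matrix (Fin n) (Fin n) ℝ} (h : IsUnit M) (b : Fin n → ℝ) :
    M⁻¹ *ᵥ (M *ᵥ b) = b := by
  rw [mulVec_mulVec, Matrix.nonsing_inv_mul _ ((Matrix.isUnit_iff_isUnit_det _).1 h), one_mulVec]

lemma res_apply {n : ℕ} (A : Matrix (Fin n) (Fin n) ℝ) (s : ℝ) (x : Fin n → ℝ) :
    (s • (1 : Matrix (Fin n) (Fin n) ℝ) - A) *ᵥ x = s • x - A *ᵥ x := by
  rw [sub_mulVec, smul_mulVec, one_mulVec]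

lemma resolvent_int {n : ℕ} {K : Set (Fin n → ℝ)} (hK : IsProperCone K)
    (A : Matrix (Fin n) (Fin n) ℝ) (hA : CrossPositive K A) (s : ℝ)
    (hinv : ∀ s' : ℝ, s ≤ s' → IsUnit (s' • (1 : Matrix (Fin n) (Fin n) ℝ) - A))
    (b : Fin n → ℝ) (hb : b ∈ interior K) :
    (s • (1 : Matrix (Fin n) (Fin n) ℝ) - A)⁻¹ *ᵥ b ∈ K := by
  let M : ℝ → Matrix (Fin n) (Fin n) ℝ := fun θ => (1 - θ) • 1 + θ • (s • 1 - A)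
  have hMc : Continuous M := by fun_prop
  have hMu : ∀ θ ∈ Set.Icc (0 : ℝ) 1, IsUnit (M θ) := by
    rintro θ ⟨h0, h1⟩
    rcases h0.eq_or_lt with rfl | hp
    · simp [M]
    · have e : M θ = θ • ((s + (1 - θ) / θ) • 1 - A) := by
        have : (1 - θ) = θ * ((1 - θ) / θ) := by field_simp
        simp only [M]
        nth_rewrite 1 [this]
        module
      rw [e]
      have := hinv (s + (1 - θ) / θ) (by
        have : 0 ≤ (1 - θ) / θ := div_nonneg (by linarith) hp.le
        linarith)
      rw [Matrix.isUnit_iff_isUnit_det] at this ⊢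
      rw [det_smul]
      exact ((IsUnit.mk0 θ hp.ne').pow _).mul this
  have hfc : ∀ θ ∈ Set.Icc (0 : ℝ) 1, ContinuousAt (fun t => (M t)⁻¹ *ᵥ b) θ :=
    fun θ hθ => inv_cont M hMc b θ (hMu θ hθ)
  have hint : ∀ θ ∈ Set.Icc (0 : ℝ) 1, (M θ)⁻¹ *ᵥ b ∈ K → (M θ)⁻¹ *ᵥ b ∈ interior K := by
    intro θ hθ hx
    by_contra hni
    obtain ⟨y, hy, hy0, hyx⟩ := cone_support hK _ hx hni
    have h1 := hA _ hx y hy hyx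
    have h2 := dual_pos hy hy0 hb
    set x := (M θ)⁻¹ *ᵥ b with hxdef
    have h3 : M θ *ᵥ x = b := mul_inv_vec (hMu θ hθ) b
    have h4 : M θ *ᵥ x = (1 - θ + θ * s) • x - θ • (A *ᵥ x) := by
      simp only [M, add_mulVec, sub_mulVec, smul_mulVec, one_mulVec]
      module
    rw [← h3, h4, dotProduct_sub, dotProduct_smul, dotProduct_smul, hyx, smul_eq_mul,
      smul_eq_mul] at h2
    have := mul_nonneg hθ.1 h1
    linarith
  have hsub : Set.Icc (0 : ℝ) 1 ⊆ {θ | (M θ)⁻¹ *ᵥ b ∈ K} := by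
    refine IsClosed.Icc_subset_of_forall_mem_nhdsWithin ?_ ?_ ?_
    · have hco : ContinuousOn (fun t => (M t)⁻¹ *ᵥ b) (Set.Icc (0 : ℝ) 1) :=
        fun θ hθ => (hfc θ hθ).continuousWithinAt
      have := hco.preimage_isClosed_of_isClosed isClosed_Icc hK.1
      rw [Set.inter_comm]
      exact this
    · simpa [M] using interior_subset hb
    · rintro θ ⟨hθ, hθ2⟩
      have hθ' : θ ∈ Set.Icc (0 : ℝ) 1 := ⟨hθ2.1, hθ2.2.le⟩
      refine mem_nhdsWithin_of_mem_nhds ?_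
      filter_upwards [(hfc θ hθ').eventually_mem (isOpen_interior.mem_nhds (hint θ hθ' hθ))]
        with t ht
      exact interior_subset ht
  have := hsub (Set.right_mem_Icc.2 zero_le_one)
  simpa [M] using this

lemma resolvent_nonneg {n : ℕ} {K : Set (Fin n → ℝ)} (hK : IsProperCone K)
    (A : Matrix (Fin n) (Fin n) ℝ) (hA : CrossPositive K A) (s : ℝ)
    (hinv : ∀ s' : ℝ, s ≤ s' → IsUnit (s' • (1 : Matrix (Fin n) (Fin n) ℝ) - A))
    (b : Fin n → ℝ) (hb : b ∈ K) :
    (s • (1 : Matrix (Fin n) (Fin n) ℝ) - A)⁻¹ *ᵥ b ∈ K := by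
  have hcl : b ∈ closure (interior K) := by
    rw [(cone_convex hK).closure_interior_eq_closure_of_nonempty_interior hK.2.2.2.2]
    exact subset_closure hb
  have hc : Continuous fun z : Fin n → ℝ => (s • (1 : Matrix (Fin n) (Fin n) ℝ) - A)⁻¹ *ᵥ z := by
    fun_prop
  exact closure_minimal (fun z hz => resolvent_int hK A hA s hinv z hz) (hK.1.preimage hc) hcl

lemma resolvent_pos {n : ℕ} {K : Set (Fin n → ℝ)} (hK : IsProperCone K)
    (A : Matrix (Fin n) (Fin n) ℝ) (hA : CrossPositive K A)
    (hIrr : ¬ ∃ v : Fin n → ℝ, v ≠ 0 ∧ v ∈ frontier K ∧ ∃ μ : ℝ, A.mulVec v = μ • v) (s : ℝ)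
    (hinv : ∀ s' : ℝ, s ≤ s' → IsUnit (s' • (1 : Matrix (Fin n) (Fin n) ℝ) - A))
    (b : Fin n → ℝ) (hb : b ∈ K) (hb0 : b ≠ 0) (c : Fin n → ℝ) (hc : c ∈ dualCone K)
    (hc0 : c ≠ 0) :
    0 < c ⬝ᵥ ((s • (1 : Matrix (Fin n) (Fin n) ℝ) - A)⁻¹ *ᵥ b) := by
  have hxK := resolvent_nonneg hK A hA s hinv b hb
  have hRx := mul_inv_vec (hinv s le_rfl) b
  set x := (s • (1 : Matrix (Fin n) (Fin n) ℝ) - A)⁻¹ *ᵥ b with hx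
  refine lt_of_le_of_ne (hc x hxK) fun hcx => hIrr ?_
  have hx0 : x ≠ 0 := by
    intro h
    rw [h, mulVec_zero] at hRx
    exact hb0 hRx.symm
  have hTu := hinv (s + 1) (by linarith)
  have hTK := resolvent_nonneg hK A hA (s + 1) (fun s' hs' => hinv s' (by linarith))
  set T := ((s + 1) • (1 : Matrix (Fin n) (Fin n) ℝ) - A)⁻¹ with hT
  have hxT : x = T *ᵥ b + T *ᵥ x := by
    rw [← mulVec_add]
    have : b + x = ((s + 1) • (1 : Matrix (Fin n) (Fin n) ℝ) - A) *ᵥ x := by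
      rw [res_apply] at hRx ⊢
      rw [← hRx]; module
    rw [this, hT, inv_mul_vec hTu]
  have hTkK : ∀ k : ℕ, ∀ z ∈ K, (T ^ k) *ᵥ z ∈ K := by
    intro k
    induction k with
    | zero => intro z hz; simpa using hz
    | succ k ih =>
      intro z hz
      rw [pow_succ, ← mulVec_mulVec]
      exact ih _ (hTK z hz)
  let F : Set (Fin n → ℝ) := {z | z ∈ K ∧ ∀ k : ℕ, c ⬝ᵥ ((T ^ k) *ᵥ z) = 0}
  have hxF : x ∈ F := by
    refine ⟨hxK, fun k => ?_⟩
    induction k with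
    | zero => simpa using hcx.symm
    | succ k ih =>
      rw [hxT, mulVec_add, dotProduct_add, mulVec_mulVec, mulVec_mulVec, ← pow_succ] at ih
      have h1 := hc _ (hTkK (k + 1) b hb)
      have h2 := hc _ (hTkK (k + 1) x hxK)
      linarith
  obtain ⟨φ, -, C, hC, hφ⟩ := cone_phi hK
  have hFcl : IsClosed F := by
    have : F = K ∩ ⋂ k : ℕ, {z | c ⬝ᵥ ((T ^ k) *ᵥ z) = 0} := by
      ext z; simp [F]
    rw [this]
    refine hK.1.inter (isClosed_iInter fun k => isClosed_eq ?_ continuous_const)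
    unfold dotProduct
    fun_prop
  obtain ⟨v, hvF, hv0, ρ, hρ⟩ := krein_rutman F hFcl
    (fun z hz w hw => ⟨hK.2.1 z hz.1 w hw.1, fun k => by
      rw [mulVec_add, dotProduct_add, hz.2, hw.2, add_zero]⟩)
    (fun a ha z hz => ⟨hK.2.2.1 a ha z hz.1, fun k => by
      rw [mulVec_smul, dotProduct_smul, hz.2, smul_zero]⟩)
    φ C (fun z hz => hφ z hz.1) hC T
    (fun z hz => ⟨hTK z hz.1, fun k => by
      rw [mulVec_mulVec, ← pow_succ]; exact hz.2 _⟩) x hxF hx0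
  have hTv := mul_inv_vec hTu v
  rw [← hT, hρ, mulVec_smul, res_apply] at hTv
  have hρ0 : ρ ≠ 0 := by
    rintro rfl
    rw [zero_smul] at hTv
    exact hv0 hTv.symm
  refine ⟨v, hv0, ?_, s + 1 - ρ⁻¹, ?_⟩
  · rw [hK.1.frontier_eq]
    refine ⟨hvF.1, fun hi => ?_⟩
    have h1 := dual_pos hc hc0 hi
    have h2 := hvF.2 0
    simp at h2
    linarith
  · have : (s + 1) • v - A *ᵥ v = ρ⁻¹ • v := by
      conv_rhs => rw [← hTv]
      rw [smul_smul, inv_mul_cancel₀ hρ0, one_smul]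
    rw [sub_smul, ← this]; abel

/-- supersolutions of the singular equation lead to a contradiction -/
lemma no_super {n : ℕ} {K : Set (Fin n → ℝ)} (hK : IsProperCone K)
    (A : Matrix (Fin n) (Fin n) ℝ) (hA : CrossPositive K A)
    (hIrr : ¬ ∃ v : Fin n → ℝ, v ≠ 0 ∧ v ∈ frontier K ∧ ∃ μ : ℝ, A.mulVec v = μ • v)
    (hinv : ∀ s' : ℝ, 0 < s' → IsUnit (s' • (1 : Matrix (Fin n) (Fin n) ℝ) - A))
    (v : Fin n → ℝ) (hv0 : v ≠ 0) (hv : A *ᵥ v = 0)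
    (b : Fin n → ℝ) (hb : b ∈ K) (hb0 : b ≠ 0)
    (x : Fin n → ℝ) (hx : x ∈ K) (hAx : A *ᵥ x = -b) : False := by
  have hint : ∀ z ∈ K, A *ᵥ z = -b → z ∈ interior K := by
    intro z hz hAz
    by_contra hni
    obtain ⟨y, hy, hy0, hyz⟩ := cone_support hK z hz hni
    have hz0 : z ≠ 0 := by
      rintro rfl
      rw [mulVec_zero] at hAz
      exact hb0 (neg_eq_zero.1 hAz.symm)
    have hzb : z + b ≠ 0 := by
      intro h
      have : -z = b := by rw [neg_eq_iff_add_eq_zero]; exact h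
      exact hz0 (hK.2.2.2.1 z hz (this ▸ hb))
    have h := resolvent_pos hK A hA hIrr 1 (fun s' hs' => hinv s' (by linarith)) (z + b)
      (hK.2.1 z hz b hb) hzb y hy hy0
    have e : z + b = ((1 : ℝ) • (1 : Matrix (Fin n) (Fin n) ℝ) - A) *ᵥ z := by
      rw [res_apply, hAz, one_smul, sub_neg_eq_add]
    rw [e, inv_mul_vec (hinv 1 one_pos), hyz] at h
    exact lt_irrefl _ h
  -- the whole line stays in the cone
  have hall : ∀ t : ℝ, x + t • v ∈ K := by
    have hc : Continuous fun t : ℝ => x + t • v := by fun_prop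
    have hclopen : IsClopen {t : ℝ | x + t • v ∈ K} := by
      refine ⟨hK.1.preimage hc, ?_⟩
      have : {t : ℝ | x + t • v ∈ K} = (fun t : ℝ => x + t • v) ⁻¹' interior K := by
        ext t
        refine ⟨fun h => hint _ h ?_, fun h => interior_subset (s := K) (a := x + t • v) h⟩
        rw [mulVec_add, mulVec_smul, hv, smul_zero, add_zero, hAx]
      rw [this]
      exact isOpen_interior.preimage hc
    have := hclopen.eq_univ ⟨0, by simpa using hx⟩
    intro t
    have ht : t ∈ {t : ℝ | x + t • v ∈ K} := by rw [this]; trivial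
    exact ht
  have hdir : ∀ w : Fin n → ℝ, (∀ t : ℝ, x + t • w ∈ K) → w ∈ K := by
    intro w hw
    by_contra hwK
    obtain ⟨y, hy, hyw⟩ := cone_sep hK w hwK
    have h := hy _ (hw ((-1 - y ⬝ᵥ x) / (y ⬝ᵥ w)))
    rw [dotProduct_add, dotProduct_smul, smul_eq_mul, div_mul_cancel₀ _ hyw.ne] at h
    linarith
  refine hv0 (hK.2.2.2.1 v (hdir v hall) (hdir (-v) fun t => ?_))
  have := hall (-t)
  rwa [neg_smul, ← smul_neg] at this

lemma part_two {n : ℕ} {K : Set (Fin n → ℝ)} (hK : IsProperCone K)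
    (A : Matrix (Fin n) (Fin n) ℝ) (hA : CrossPositive K A)
    (hIrr : ¬ ∃ v : Fin n → ℝ, v ≠ 0 ∧ v ∈ frontier K ∧ ∃ μ : ℝ, A.mulVec v = μ • v)
    (hinv : ∀ s' : ℝ, 0 < s' → IsUnit (s' • (1 : Matrix (Fin n) (Fin n) ℝ) - A))
    (v : Fin n → ℝ) (hv0 : v ≠ 0) (hv : A *ᵥ v = 0)
    (b : Fin n → ℝ) (hb : b ∈ K) (hb0 : b ≠ 0)
    (ξ : Fin n → ℝ) (hξ : A *ᵥ ξ = b) : False := by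
  obtain ⟨φ, hφd, C, hC, hφ⟩ := cone_phi hK
  have hφc : Continuous fun z : Fin n → ℝ => φ ⬝ᵥ z := by unfold dotProduct; fun_prop
  let P : Set ((Fin n → ℝ) × ℝ) :=
    {p | p.1 ∈ K ∧ p.2 ∈ Set.Icc (0 : ℝ) 1 ∧ φ ⬝ᵥ p.1 + p.2 = 1}
  have hPcl : IsClosed P := by
    refine (hK.1.preimage continuous_fst).inter ((isClosed_Icc.preimage continuous_snd).inter ?_)
    exact isClosed_eq ((hφc.comp continuous_fst).add continuous_snd) continuous_const
  have hbd : ∀ p ∈ P, ‖p.1‖ ≤ C := by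
    rintro ⟨z, r⟩ ⟨hz, hr, he⟩
    simp only at hz hr he ⊢
    have h1 := hφ z hz
    have h2 := hr.1
    nlinarith
  have hPc : IsCompact P := by
    refine IsCompact.of_isClosed_subset
      ((isCompact_closedBall (0 : Fin n → ℝ) C).prod (isCompact_Icc (a := (0 : ℝ)) (b := 1)))
      hPcl ?_
    intro p hp
    exact ⟨by simpa using hbd p hp, hp.2.1⟩
  have key : ∀ s : ℝ, 0 < s → ∃ p ∈ P, ‖A *ᵥ p.1 + p.2 • b‖ ≤ s * C := by
    intro s hs
    have hxK := resolvent_nonneg hK A hA s (fun s' hs' => hinv s' (hs.trans_le hs')) b hb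
    have hx := mul_inv_vec (hinv s hs) b
    set x := (s • (1 : Matrix (Fin n) (Fin n) ℝ) - A)⁻¹ *ᵥ b
    rw [res_apply] at hx
    have hp := hφd x hxK
    set r := (1 + φ ⬝ᵥ x)⁻¹ with hr
    have hr0 : 0 < r := by positivity
    have hr1 : r * (1 + φ ⬝ᵥ x) = 1 := inv_mul_cancel₀ (by positivity)
    have hmem : (r • x, r) ∈ P := by
      refine ⟨hK.2.2.1 r hr0.le x hxK, ⟨hr0.le, ?_⟩, ?_⟩
      · simp only; nlinarith
      · simp only [dotProduct_smul, smul_eq_mul]; linarith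
    refine ⟨_, hmem, ?_⟩
    have e : A *ᵥ (r • x) + r • b = s • (r • x) := by
      rw [mulVec_smul, ← hx]; module
    simp only
    rw [e, norm_smul, Real.norm_of_nonneg hs.le]
    exact mul_le_mul_of_nonneg_left (hbd _ hmem) hs.le
  obtain ⟨⟨z, r⟩, hzP, hmin⟩ := hPc.exists_isMinOn (let ⟨p, hp, _⟩ := key 1 one_pos; ⟨p, hp⟩)
    (f := fun p : (Fin n → ℝ) × ℝ => ‖A *ᵥ p.1 + p.2 • b‖)
    (by fun_prop : Continuous fun p : (Fin n → ℝ) × ℝ => ‖A *ᵥ p.1 + p.2 • b‖).continuousOn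
  have hz0 : A *ᵥ z + r • b = 0 := by
    rw [← norm_eq_zero]
    by_contra hne
    have hp : 0 < ‖A *ᵥ z + r • b‖ := lt_of_le_of_ne (norm_nonneg _) (Ne.symm hne)
    obtain ⟨p, hpP, hpl⟩ := key (‖A *ᵥ z + r • b‖ / (2 * C)) (by positivity)
    have h1 : ‖A *ᵥ z + r • b‖ ≤ _ := isMinOn_iff.1 hmin p hpP
    have h2 : ‖A *ᵥ z + r • b‖ / (2 * C) * C = ‖A *ᵥ z + r • b‖ / 2 := by field_simp
    linarith
  obtain ⟨hzK, hr, he⟩ := hzP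
  simp only at hzK hr he
  rcases hr.1.eq_or_lt with h0 | hpos
  · -- kernel vector in the cone
    rw [← h0] at hz0 he
    rw [zero_smul, add_zero] at hz0
    have hzne : z ≠ 0 := by
      rintro rfl
      simp at he
    have hzi : z ∈ interior K := by
      by_contra hni
      refine hIrr ⟨z, hzne, ?_, 0, by rw [hz0, zero_smul]⟩
      rw [hK.1.frontier_eq]
      exact ⟨hzK, hni⟩
    have hc : Continuous fun t : ℝ => z - t • ξ := by fun_prop
    have hev : ∀ᶠ t in nhds (0 : ℝ), z - t • ξ ∈ interior K :=
      hc.continuousAt.eventually_mem (by simpa using isOpen_interior.mem_nhds hzi)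
    obtain ⟨δ, hδ, hball⟩ := Metric.eventually_nhds_iff.1 hev
    have hm := interior_subset (hball (y := δ / 2) (by simp [abs_of_pos hδ]; linarith))
    have hm2 := hK.2.2.1 (δ / 2)⁻¹ (by positivity) _ hm
    refine no_super hK A hA hIrr hinv v hv0 hv b hb hb0 _ hm2 ?_
    rw [mulVec_smul, mulVec_sub, mulVec_smul, hz0, hξ, zero_sub, smul_neg, smul_smul,
      inv_mul_cancel₀ (by positivity), one_smul]
  · refine no_super hK A hA hIrr hinv v hv0 hv b hb hb0 (r⁻¹ • z)
      (hK.2.2.1 _ (by positivity) z hzK) ?_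
    rw [mulVec_smul, eq_neg_of_add_eq_zero_left hz0, smul_neg, smul_smul,
      inv_mul_cancel₀ hpos.ne', one_smul]

/-- Sensor placement for a marginally stable cone-invariant system: for a `K`-irreducible
cross-positive `A` whose complex eigenvalues all have nonpositive real part,
(i) for every `s₀ > 0`, `s₀ I − A` is invertible and `⟨c, (s₀ I − A)⁻¹ b⟩ > 0` for all
nonzero `b ∈ K`, nonzero `c ∈ K*`; (ii) if `0` is an eigenvalue of `A`, no nonzero
`b ∈ K` lies in the column space of `A`; consequently (iii) for coordinates `eᵢ ∈ K`,
`eⱼ ∈ K*`, every solution `(ζ, d₀)` of the Rosenbrock equations with `s₀ ≥ 0` has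
`d₀ = 0`: the single sensor `eⱼ` defends against every zero-dynamics attack
`d(t) = −e^{s₀ t} d₀` entering through `eᵢ`. -/
theorem stmt11 {n : ℕ} (K : Set (Fin n → ℝ)) (hK : IsProperCone K)
    (A : Matrix (Fin n) (Fin n) ℝ) (hCross : CrossPositive K A)
    (hIrr : ¬ ∃ v : Fin n → ℝ, v ≠ 0 ∧ v ∈ frontier K ∧ ∃ μ : ℝ, A.mulVec v = μ • v)
    (hMarg : ∀ μ : ℂ, HasEigen (A.map Complex.ofReal) μ → μ.re ≤ 0) :
    (∀ s₀ : ℝ, 0 < s₀ →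
      IsUnit (s₀ • (1 : Matrix (Fin n) (Fin n) ℝ) - A) ∧
      ∀ b ∈ K, b ≠ 0 → ∀ c ∈ dualCone K, c ≠ 0 →
        0 < c ⬝ᵥ ((s₀ • (1 : Matrix (Fin n) (Fin n) ℝ) - A)⁻¹).mulVec b) ∧
    ((∃ v : Fin n → ℝ, v ≠ 0 ∧ A.mulVec v = 0) →
      ∀ b ∈ K, b ≠ 0 → ¬ ∃ ξ : Fin n → ℝ, A.mulVec ξ = b) ∧
    (∀ i j : Fin n, (Pi.single i 1 : Fin n → ℝ) ∈ K →
      (Pi.single j 1 : Fin n → ℝ) ∈ dualCone K →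
      ∀ s₀ : ℝ, 0 ≤ s₀ → ∀ (ζ : Fin n → ℝ) (d₀ : ℝ),
        (s₀ • (1 : Matrix (Fin n) (Fin n) ℝ) - A).mulVec ζ
            + d₀ • (Pi.single i 1 : Fin n → ℝ) = 0 →
        (Pi.single j 1 : Fin n → ℝ) ⬝ᵥ ζ = 0 → d₀ = 0) := by
  have hinv : ∀ s' : ℝ, 0 < s' → IsUnit (s' • (1 : Matrix (Fin n) (Fin n) ℝ) - A) := by
    intro s hs
    by_contra hnu
    rw [Matrix.isUnit_iff_isUnit_det, isUnit_iff_ne_zero, not_not] at hnu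
    obtain ⟨v, hv0, hv⟩ := Matrix.exists_mulVec_eq_zero_iff.2 hnu
    rw [res_apply, sub_eq_zero] at hv
    have := hMarg (s : ℂ) ⟨fun i => (v i : ℂ), ?_, ?_⟩
    · simp only [Complex.ofReal_re] at this
      linarith
    · intro h
      apply hv0
      ext i
      have := congrFun h i
      simpa using this
    · ext i
      have := congrFun hv i
      simp only [mulVec, dotProduct, Matrix.map_apply, Pi.smul_apply, smul_eq_mul] at this ⊢
      exact_mod_cast this.symm
  have h1 : ∀ s₀ : ℝ, 0 < s₀ →
      IsUnit (s₀ • (1 : Matrix (Fin n) (Fin n) ℝ) - A) ∧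
      ∀ b ∈ K, b ≠ 0 → ∀ c ∈ dualCone K, c ≠ 0 →
        0 < c ⬝ᵥ ((s₀ • (1 : Matrix (Fin n) (Fin n) ℝ) - A)⁻¹).mulVec b :=
    fun s hs => ⟨hinv s hs, fun b hb hb0 c hc hc0 =>
      resolvent_pos hK A hCross hIrr s (fun s' hs' => hinv s' (hs.trans_le hs')) b hb hb0 c hc hc0⟩
  have h2 : (∃ v : Fin n → ℝ, v ≠ 0 ∧ A.mulVec v = 0) →
      ∀ b ∈ K, b ≠ 0 → ¬ ∃ ξ : Fin n → ℝ, A.mulVec ξ = b := by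
    rintro ⟨v, hv0, hv⟩ b hb hb0 ⟨ξ, hξ⟩
    exact part_two hK A hCross hIrr hinv v hv0 hv b hb hb0 ξ hξ
  refine ⟨h1, h2, ?_⟩
  intro i j hi hj s hs ζ d heq hζ
  have hne : ∀ k : Fin n, (Pi.single k 1 : Fin n → ℝ) ≠ 0 := fun k h => by
    have := congrFun h k
    simp at this
  by_cases hall : ∀ s' : ℝ, s ≤ s' → IsUnit (s' • (1 : Matrix (Fin n) (Fin n) ℝ) - A)
  · have hp := resolvent_pos hK A hCross hIrr s hall _ hi (hne i) _ hj (hne j)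
    have e := inv_mul_vec (hall s le_rfl) ζ
    rw [eq_neg_of_add_eq_zero_left heq, mulVec_neg, mulVec_smul] at e
    rw [← e, dotProduct_neg, dotProduct_smul, smul_eq_mul, neg_eq_zero] at hζ
    exact (mul_eq_zero.1 hζ).resolve_right hp.ne'
  · push Not at hall
    obtain ⟨s', hs', hnu⟩ := hall
    have hs0 : s' = 0 := by
      by_contra h
      exact hnu (hinv s' (lt_of_le_of_ne (hs.trans hs') (Ne.symm h)))
    subst hs0
    have hs0 : s = 0 := le_antisymm hs' hs
    subst hs0
    rw [Matrix.isUnit_iff_isUnit_det, isUnit_iff_ne_zero, not_not] at hnu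
    obtain ⟨v, hv0, hv⟩ := Matrix.exists_mulVec_eq_zero_iff.2 hnu
    rw [res_apply, zero_smul, zero_sub, neg_eq_zero] at hv
    rw [res_apply, zero_smul, zero_sub] at heq
    by_contra hd
    refine h2 ⟨v, hv0, hv⟩ _ hi (hne i) ⟨d⁻¹ • ζ, ?_⟩
    have : A *ᵥ ζ = d • (Pi.single i 1 : Fin n → ℝ) := by
      rw [neg_add_eq_zero] at heq; exact heq
    rw [mulVec_smul, this, smul_smul, inv_mul_cancel₀ hd, one_smul]
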